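/- Let S = R ∪ B be a bicolored point set in convex position with |R| = |B| = n ≥ 2. Then every bridge of S is an edge of any Hamiltonian alternating cycle on S having exactly n − r(S) crossings. -/

import Mathlib

open scoped Classical

noncomputable section

/-- Points of the plane. -/
abbrev Pt := ℝ × ℝ

/-- Orientation determinant of the ordered triple `(a, b, c)`. -/
def det2 (a b c : Pt) : ℝ :=
  (b.1 - a.1) * (c.2 - a.2) - (b.2 - a.2) * (c.1 - a.1)

/-- Two closed segments cross: some point lies in the relative interior of both. -/
def SegCross (e f : Pt × Pt) : Prop :=
  ∃ x : Pt, x ∈ openSegment ℝ e.1 e.2 ∧ x ∈ openSegment ℝ f.1 f.2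

/-- Number of crossings (unordered pairs of crossing edges) among a list of edges. -/
def crossNum (es : List (Pt × Pt)) : ℕ :=
  ((Finset.range es.length ×ˢ Finset.range es.length).filter
    (fun ij => ij.1 < ij.2 ∧
      SegCross (es.getD ij.1 ((0, 0), (0, 0))) (es.getD ij.2 ((0, 0), (0, 0))))).card

/-- Number of other edges crossing the `i`-th edge of the list. -/
def edgeCrossCount (es : List (Pt × Pt)) (i : ℕ) : ℕ :=
  ((Finset.range es.length).filter (fun j => j ≠ i ∧
      SegCross (es.getD i ((0, 0), (0, 0))) (es.getD j ((0, 0), (0, 0))))).card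

/-- Every edge is crossed by at most one other edge. -/
def OnePlane (es : List (Pt × Pt)) : Prop :=
  ∀ i ∈ Finset.range es.length, edgeCrossCount es i ≤ 1

/-- The edges of a path given by its list of vertices. -/
def pathEdges (l : List Pt) : List (Pt × Pt) := l.zip l.tail

/-- The edges of a cycle given by its list of vertices (including the wrap-around edge). -/
def cycleEdges (l : List Pt) : List (Pt × Pt) := l.zip (l.rotate 1)

/-- An edge joining a point of `R` to a point of `B`. -/
def Bichromatic (R B : Finset Pt) (e : Pt × Pt) : Prop :=
  (e.1 ∈ R ∧ e.2 ∈ B) ∨ (e.1 ∈ B ∧ e.2 ∈ R)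

/-- A Hamiltonian alternating path on the bicolored point set `R ∪ B`
with endpoints `p` and `q`. -/
structure HamAltPath (R B : Finset Pt) (p q : Pt) where
  verts : List Pt
  nodup : verts.Nodup
  cover : verts.toFinset = R ∪ B
  head_eq : verts.head? = some p
  last_eq : verts.getLast? = some q
  alt : ∀ e ∈ pathEdges verts, Bichromatic R B e

/-- A Hamiltonian alternating cycle on the bicolored point set `R ∪ B`. -/
structure HamAltCycle (R B : Finset Pt) where
  verts : List Pt
  nodup : verts.Nodup
  cover : verts.toFinset = R ∪ B
  alt : ∀ e ∈ cycleEdges verts, Bichromatic R B e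

/-- A Hamiltonian alternating path with prescribed endpoints is optimum if it has the
minimum number of crossings among all such paths. -/
def OptimumPath (R B : Finset Pt) (p q : Pt) (P : HamAltPath R B p q) : Prop :=
  ∀ Q : HamAltPath R B p q, crossNum (pathEdges P.verts) ≤ crossNum (pathEdges Q.verts)

/-- No three points of `S` are collinear. -/
def GeneralPosition (S : Finset Pt) : Prop :=
  ∀ p ∈ S, ∀ q ∈ S, ∀ r ∈ S, p ≠ q → p ≠ r → q ≠ r → ¬ Collinear ℝ ({p, q, r} : Set Pt)

/-- Every point of `S` is a vertex (extreme point) of its convex hull. -/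
def ConvexPosition (S : Finset Pt) : Prop :=
  ∀ p ∈ S, p ∉ convexHull ℝ ((S.erase p : Finset Pt) : Set Pt)

/-- The points of `S` lying on the boundary of the convex hull of `S`
(i.e. the extreme points of `S`). -/
def hullPts (S : Finset Pt) : Finset Pt :=
  S.filter fun p => p ∉ convexHull ℝ ((S.erase p : Finset Pt) : Set Pt)

/-- Cyclic successor on `Fin m`. -/
def cycSucc {m : ℕ} (hm : 0 < m) (i : Fin m) : Fin m :=
  ⟨(i.val + 1) % m, Nat.mod_lt _ hm⟩

/-- Cyclic predecessor on `Fin m`. -/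
def cycPred {m : ℕ} (hm : 0 < m) (i : Fin m) : Fin m :=
  ⟨(i.val + (m - 1)) % m, Nat.mod_lt _ hm⟩

/-- `pt` lists points in convex position, in clockwise circular order:
every index-increasing triple is clockwise oriented. -/
def CWList {m : ℕ} (pt : Fin m → Pt) : Prop :=
  Function.Injective pt ∧
    ∀ i j k : Fin m, i < j → j < k → det2 (pt i) (pt j) (pt k) < 0

/-- `pt` is a clockwise listing of the points of `S` on the boundary of `CH(S)`. -/
def IsHullList (S : Finset Pt) {m : ℕ} (pt : Fin m → Pt) : Prop :=
  CWList pt ∧ Finset.univ.image pt = hullPts S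

/-- The number of runs of color `A` (with other color `C`) in the cyclic sequence `pt`:
a run starts at an `A`-point whose cyclic predecessor is a `C`-point; a completely
`A`-colored cycle forms a single run. -/
def runCount {m : ℕ} (hm : 0 < m) (A C : Finset Pt) (pt : Fin m → Pt) : ℕ :=
  if ∀ i : Fin m, pt i ∈ A then 1
  else (Finset.univ.filter fun i : Fin m => pt i ∈ A ∧ pt (cycPred hm i) ∈ C).card

/-- `q` is the counterclockwise radial order of the points of `T` around `r`. -/
def CCWOrder (r : Pt) {k : ℕ} (q : Fin k → Pt) (T : Finset Pt) : Prop :=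
  Function.Injective q ∧ Finset.univ.image q = T ∧
    ∀ i j : Fin k, i < j → 0 < det2 r (q i) (q j)

/-- `q` is the clockwise radial order of the points of `T` around `r`. -/
def CWOrder (r : Pt) {k : ℕ} (q : Fin k → Pt) (T : Finset Pt) : Prop :=
  Function.Injective q ∧ Finset.univ.image q = T ∧
    ∀ i j : Fin k, i < j → det2 r (q i) (q j) < 0

/-- Counting one extra point of color `A` (the center), the initial segment
`q 0, …, q j` contains equally many points of color `A` and of color `C`. -/
def BalancedAt (A C : Finset Pt) {k : ℕ} (q : Fin k → Pt) (j : Fin k) : Prop :=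
  1 + (Finset.univ.filter fun i : Fin k => i ≤ j ∧ q i ∈ A).card
    = (Finset.univ.filter fun i : Fin k => i ≤ j ∧ q i ∈ C).card

/-- `j` is the first balanced index of the sequence `q`. -/
def FirstBalanced (A C : Finset Pt) {k : ℕ} (q : Fin k → Pt) (j : Fin k) : Prop :=
  BalancedAt A C q j ∧ ∀ j' : Fin k, j' < j → ¬ BalancedAt A C q j'

/-- The triple `(R ∪ B, r, b)` is a special configuration (Definition 2.2):
(i) both neighbors of `r` on the hull boundary are red and both neighbors of `b` are
blue; (ii) in the counterclockwise and clockwise radial orders around `r`, the first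
balanced point is `b`; (iii) symmetrically around `b`, the first balanced point is `r`. -/
def SpecialConfig (R B : Finset Pt) (r b : Pt) : Prop :=
  r ∈ hullPts (R ∪ B) ∧ b ∈ hullPts (R ∪ B) ∧
  (∀ (m : ℕ) (hm : 0 < m) (pt : Fin m → Pt), IsHullList (R ∪ B) pt →
    ∀ i : Fin m,
      (pt i = r → pt (cycPred hm i) ∈ R ∧ pt (cycSucc hm i) ∈ R) ∧
      (pt i = b → pt (cycPred hm i) ∈ B ∧ pt (cycSucc hm i) ∈ B)) ∧
  (∀ (k : ℕ) (q : Fin k → Pt),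
      (CCWOrder r q ((R ∪ B).erase r) ∨ CWOrder r q ((R ∪ B).erase r)) →
      ∀ j : Fin k, FirstBalanced R B q j → q j = b) ∧
  (∀ (k : ℕ) (q : Fin k → Pt),
      (CCWOrder b q ((R ∪ B).erase b) ∨ CWOrder b q ((R ∪ B).erase b)) →
      ∀ j : Fin k, FirstBalanced B R q j → q j = r)

/-- The unordered pair `{a, b}` occurs as an edge of the list `es`. -/
def IsEdgeOf (es : List (Pt × Pt)) (a b : Pt) : Prop := (a, b) ∈ es ∨ (b, a) ∈ es

/-- The clockwise cyclic interval of indices from `a` to `b`, inclusive. -/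
def cycIdx {m : ℕ} (hm : 0 < m) (a b : Fin m) : Finset (Fin m) :=
  (Finset.range ((b.val + m - a.val) % m + 1)).image
    fun t => (⟨(a.val + t) % m, Nat.mod_lt _ hm⟩ : Fin m)

lemma segCross_symm {e f : Pt × Pt} (h : SegCross e f) : SegCross f e := by
  obtain ⟨x, he, hf⟩ := h
  exact ⟨x, hf, he⟩

lemma segCross_swap_left {a b : Pt} {f : Pt × Pt} (h : SegCross (a, b) f) :
    SegCross (b, a) f := by
  obtain ⟨x, he, hf⟩ := h
  exact ⟨x, by simpa [openSegment_symm] using he, hf⟩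

lemma segCross_swap_right {a b : Pt} {e : Pt × Pt} (h : SegCross e (a, b)) :
    SegCross e (b, a) :=
  segCross_symm (segCross_swap_left (segCross_symm h))

/-- The diagonals of a convex quadrilateral cross. -/
lemma segCross_of_det2_neg {a b c d : Pt} (h₁ : det2 a c b < 0) (h₂ : det2 a b d < 0)
    (h₃ : det2 a c d < 0) (h₄ : det2 c b d < 0) : SegCross (a, b) (c, d) := by
  have hs : det2 a c b + det2 a b d = det2 a c d + det2 c b d := by
    unfold det2; ring
  have hne : det2 a c b + det2 a b d ≠ 0 := by linarith
  have hne' : det2 a c d + det2 c b d ≠ 0 := by linarith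
  refine ⟨(det2 c b d / (det2 a c d + det2 c b d)) • a
      + (det2 a c d / (det2 a c d + det2 c b d)) • b, ?_, ?_⟩
  · refine ⟨_, _, div_pos_of_neg_of_neg h₄ (by linarith),
      div_pos_of_neg_of_neg h₃ (by linarith), ?_, rfl⟩
    field_simp
    ring
  · refine ⟨det2 a b d / (det2 a c b + det2 a b d), det2 a c b / (det2 a c b + det2 a b d),
      div_pos_of_neg_of_neg h₂ (by linarith), div_pos_of_neg_of_neg h₁ (by linarith), ?_, ?_⟩
    · field_simp
      ring
    · rw [hs]
      ext
      · simp only [Prod.fst_add, Prod.smul_fst, smul_eq_mul]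
        field_simp
        unfold det2
        ring
      · simp only [Prod.snd_add, Prod.smul_snd, smul_eq_mul]
        field_simp
        unfold det2
        ring

lemma CWList.segCross {m : ℕ} {pt : Fin m → Pt} (h : CWList pt) {a b c d : Fin m}
    (hac : a < c) (hcb : c < b) (hbd : b < d) : SegCross (pt a, pt b) (pt c, pt d) :=
  segCross_of_det2_neg (h.2 _ _ _ hac hcb) (h.2 _ _ _ (hac.trans hcb) hbd)
    (h.2 _ _ _ hac (hcb.trans hbd)) (h.2 _ _ _ hcb hbd)

/-- Two chords whose endpoints are separated cross. -/
lemma CWList.segCross_of_separated {m : ℕ} {pt : Fin m → Pt} (h : CWList pt)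
    {a b c d : Fin m} (hac : a < c) (hcb : c < b) (hd : d < a ∨ b < d) :
    SegCross (pt a, pt b) (pt c, pt d) := by
  rcases hd with hd | hd
  · exact segCross_swap_right (segCross_symm (h.segCross hd hac hcb))
  · exact h.segCross hac hcb hd

lemma cycSucc_injective {m : ℕ} (hm : 0 < m) : Function.Injective (cycSucc hm) := by
  intro i j h
  have h' : (i.val + 1) % m = (j.val + 1) % m := congrArg Fin.val h
  have hi := i.isLt
  have hj := j.isLt
  ext
  have e : ∀ k < m, (k + 1) % m = if k + 1 = m then 0 else k + 1 := by
    intro k hk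
    split_ifs with hh
    · rw [hh, Nat.mod_self]
    · exact Nat.mod_eq_of_lt (by omega)
  rw [e _ hi, e _ hj] at h'
  split_ifs at h' <;> omega

lemma cycSucc_val {m : ℕ} (hm : 0 < m) (i : Fin m) :
    (cycSucc hm i).val = if i.val + 1 = m then 0 else i.val + 1 := by
  have hi := i.isLt
  show (i.val + 1) % m = _
  split_ifs with hh
  · rw [hh, Nat.mod_self]
  · exact Nat.mod_eq_of_lt (by omega)

lemma cycPred_cycSucc {m : ℕ} (hm : 0 < m) (i : Fin m) : cycPred hm (cycSucc hm i) = i := by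
  have hi := i.isLt
  ext
  show ((cycSucc hm i).val + (m - 1)) % m = i.val
  rw [cycSucc_val]
  split_ifs with hh
  · rw [Nat.mod_eq_of_lt (by omega)]
    omega
  · rw [show i.val + 1 + (m - 1) = i.val + m by omega, Nat.add_mod_right, Nat.mod_eq_of_lt hi]

lemma cycSucc_bijective {m : ℕ} (hm : 0 < m) : Function.Bijective (cycSucc hm) :=
  Finite.injective_iff_bijective.1 (cycSucc_injective hm)

lemma cycSucc_ne_self {m : ℕ} (hm : 0 < m) (h : 2 ≤ m) (i : Fin m) : cycSucc hm i ≠ i := by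
  intro e
  have e' := congrArg Fin.val e
  rw [cycSucc_val] at e'
  have hi := i.isLt
  split_ifs at e' <;> omega

lemma cycSucc_cycSucc_ne_self {m : ℕ} (hm : 0 < m) (h : 3 ≤ m) (i : Fin m) :
    cycSucc hm (cycSucc hm i) ≠ i := by
  intro e
  have e' := congrArg Fin.val e
  rw [cycSucc_val, cycSucc_val] at e'
  have hi := i.isLt
  split_ifs at e' <;> omega

/-- On a cycle with the edge from `j` to its successor deleted, a property that is neither
true nor false at all inner vertices changes along some edge between inner vertices. -/
lemma exists_change {m : ℕ} (hm : 0 < m) (T : Fin m → Prop) (j x y : Fin m)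
    (hxj : x ≠ j) (hxs : x ≠ cycSucc hm j) (hyj : y ≠ j) (hys : y ≠ cycSucc hm j)
    (hx : T x) (hy : ¬ T y) :
    ∃ k, k ≠ j ∧ k ≠ cycSucc hm j ∧ cycSucc hm k ≠ j ∧ cycSucc hm k ≠ cycSucc hm j ∧
      ¬ (T k ↔ T (cycSucc hm k)) := by
  by_contra! hcon
  let f : ℕ → Fin m := fun t => ⟨(j.val + 2 + t) % m, Nat.mod_lt _ hm⟩
  have hval : ∀ t, t < m → (f t).val = if j.val + 2 + t < m then j.val + 2 + t
      else if j.val + 2 + t < 2 * m then j.val + 2 + t - m else j.val + 2 + t - 2 * m := by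
    intro t ht
    have hj := j.isLt
    show (j.val + 2 + t) % m = _
    split_ifs with h1 h2
    · exact Nat.mod_eq_of_lt h1
    · rw [Nat.mod_eq_sub_mod (by omega), Nat.mod_eq_of_lt (by omega)]
    · rw [Nat.mod_eq_sub_mod (by omega), Nat.mod_eq_sub_mod (by omega),
        Nat.mod_eq_of_lt (by omega)]
      omega
  have hsucc : ∀ t, cycSucc hm (f t) = f (t + 1) := by
    intro t
    ext
    show ((j.val + 2 + t) % m + 1) % m = (j.val + 2 + (t + 1)) % m
    rw [Nat.mod_add_mod]
    rfl
  have hconst : ∀ t, t + 2 < m → (T (f 0) ↔ T (f t)) := by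
    intro t
    induction t with
    | zero => simp
    | succ t ih =>
      intro ht
      rw [ih (by omega), ← hsucc t]
      have hj := j.isLt
      apply hcon <;> rw [Ne, Fin.ext_iff] <;> (try rw [hsucc]) <;> rw [hval _ (by omega)] <;>
        (try rw [cycSucc_val hm j]) <;> split_ifs <;> omega
  have hsurj : ∀ z, z ≠ j → z ≠ cycSucc hm j → ∃ t, t + 2 < m ∧ f t = z := by
    intro z hz hzs
    have hz' : z.val ≠ j.val := fun h => hz (Fin.ext h)
    have hzs' : z.val ≠ (cycSucc hm j).val := fun h => hzs (Fin.ext h)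
    rw [cycSucc_val] at hzs'
    have hj := j.isLt
    have hzl := z.isLt
    by_cases h : j.val + 2 ≤ z.val
    · refine ⟨z.val - (j.val + 2), by omega, ?_⟩
      ext
      rw [hval _ (by omega)]
      split_ifs <;> omega
    · refine ⟨z.val + m - (j.val + 2), by split_ifs at hzs' <;> omega, ?_⟩
      ext
      split_ifs at hzs' <;> rw [hval _ (by omega)] <;> split_ifs <;> omega
  obtain ⟨s, hs, rfl⟩ := hsurj x hxj hxs
  obtain ⟨t, ht, rfl⟩ := hsurj y hyj hys
  exact hy ((hconst t ht).1 ((hconst s hs).2 hx))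

/-- Every edge of a Hamiltonian polygon on points in convex position that is not an edge of
the convex hull is crossed by another edge of the polygon. -/
lemma exists_segCross {m : ℕ} (hm : 0 < m) {pt : Fin m → Pt} (hcw : CWList pt)
    (σ : Equiv.Perm (Fin m)) (j : Fin m)
    (h₁ : σ (cycSucc hm j) ≠ cycSucc hm (σ j)) (h₂ : σ j ≠ cycSucc hm (σ (cycSucc hm j)))
    (hne : cycSucc hm j ≠ j) :
    ∃ k, k ≠ j ∧ SegCross (pt (σ j), pt (σ (cycSucc hm j)))
      (pt (σ k), pt (σ (cycSucc hm k))) := by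
  have key : ∀ a b : Fin m, a < b → b ≠ cycSucc hm a → a ≠ cycSucc hm b →
      (∀ k, k ≠ j → k ≠ cycSucc hm j → σ k ≠ a ∧ σ k ≠ b) →
      (∀ z, z ≠ a → z ≠ b → σ.symm z ≠ j ∧ σ.symm z ≠ cycSucc hm j) →
      ∃ k, k ≠ j ∧ SegCross (pt a, pt b) (pt (σ k), pt (σ (cycSucc hm k))) := by
    intro a b hab hb ha hk hz
    have hb' : b.val ≠ (cycSucc hm a).val := fun h => hb (Fin.ext h)
    have ha' : a.val ≠ (cycSucc hm b).val := fun h => ha (Fin.ext h)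
    rw [cycSucc_val] at hb' ha'
    have hal := a.isLt
    have hbl := b.isLt
    rw [Fin.lt_def] at hab
    rw [if_neg (by omega)] at hb'
    let c : Fin m := ⟨a.val + 1, by omega⟩
    have hcd : ∃ d : Fin m, d < a ∨ b < d := by
      by_cases h : b.val + 1 = m
      · rw [if_pos h] at ha'
        exact ⟨⟨0, hm⟩, Or.inl (Fin.lt_def.2 (by simp; omega))⟩
      · exact ⟨⟨b.val + 1, by omega⟩, Or.inr (Fin.lt_def.2 (by simp))⟩
    obtain ⟨d, hd⟩ := hcd
    have hc : a < c ∧ c < b := by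
      constructor <;> rw [Fin.lt_def] <;> simp only [c] <;> omega
    have hcz := hz c hc.1.ne' hc.2.ne
    have hdz := hz d (by rintro rfl; rcases hd with h | h <;> rw [Fin.lt_def] at h <;> omega)
      (by rintro rfl; rcases hd with h | h <;> rw [Fin.lt_def] at h <;> omega)
    obtain ⟨k, hkj, hks, hsj, hss, hT⟩ := exists_change hm (fun k => a < σ k ∧ σ k < b) j
      (σ.symm c) (σ.symm d) hcz.1 hcz.2 hdz.1 hdz.2 (by simpa using hc)
      (by
        simp only [Equiv.apply_symm_apply, not_and, not_lt]
        intro h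
        rcases hd with hd | hd
        · exact absurd h hd.not_gt
        · exact hd.le)
    refine ⟨k, hkj, ?_⟩
    have out : ∀ z, z ≠ a → z ≠ b → ¬ (a < z ∧ z < b) → z < a ∨ b < z := by
      intro z hza hzb h
      rcases lt_or_gt_of_ne hza with h1 | h1
      · exact Or.inl h1
      · rcases lt_or_gt_of_ne hzb with h2 | h2
        · exact absurd ⟨h1, h2⟩ h
        · exact Or.inr h2
    have hk1 := hk k hkj hks
    have hk2 := hk _ hsj hss
    by_cases hin : a < σ k ∧ σ k < b
    · have hout : ¬ (a < σ (cycSucc hm k) ∧ σ (cycSucc hm k) < b) := by tauto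
      exact hcw.segCross_of_separated hin.1 hin.2 (out _ hk2.1 hk2.2 hout)
    · have hin' : a < σ (cycSucc hm k) ∧ σ (cycSucc hm k) < b := by tauto
      exact segCross_swap_right
        (hcw.segCross_of_separated hin'.1 hin'.2 (out _ hk1.1 hk1.2 hin))
  have hσ : σ j ≠ σ (cycSucc hm j) := fun h => hne (σ.injective h).symm
  rcases lt_or_gt_of_ne hσ with hlt | hlt
  · refine key _ _ hlt h₁ h₂ (fun k h h' => ⟨by simpa using h, by simpa using h'⟩) ?_
    intro z hz hz'
    exact ⟨fun h => hz (by rw [← h]; simp), fun h => hz' (by rw [← h]; simp)⟩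
  · obtain ⟨k, hk, hc⟩ := key _ _ hlt h₂ h₁
      (fun k h h' => ⟨by simpa using h', by simpa using h⟩)
      (fun z hz hz' => ⟨fun h => hz' (by rw [← h]; simp), fun h => hz (by rw [← h]; simp)⟩)
    exact ⟨k, hk, segCross_swap_left hc⟩

/-- The number of edges that are crossed is at most twice the number of crossings. -/
lemma card_le_two_mul_crossNum (es : List (Pt × Pt)) (s : Finset ℕ)
    (hs : ∀ i ∈ s, i < es.length ∧ ∃ j < es.length, j ≠ i ∧
      SegCross (es.getD i ((0, 0), (0, 0))) (es.getD j ((0, 0), (0, 0)))) :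
    s.card ≤ 2 * crossNum es := by
  unfold crossNum
  set P := (Finset.range es.length ×ˢ Finset.range es.length).filter
    (fun ij => ij.1 < ij.2 ∧
      SegCross (es.getD ij.1 ((0, 0), (0, 0))) (es.getD ij.2 ((0, 0), (0, 0)))) with hP
  have hsub : s ⊆ P.image Prod.fst ∪ P.image Prod.snd := by
    intro i hi
    obtain ⟨hil, j, hjl, hji, hc⟩ := hs i hi
    rw [Finset.mem_union, Finset.mem_image, Finset.mem_image]
    rcases lt_or_gt_of_ne hji with h | h
    · refine Or.inr ⟨(j, i), ?_, rfl⟩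
      simp only [hP, Finset.mem_filter, Finset.mem_product, Finset.mem_range]
      exact ⟨⟨hjl, hil⟩, h, segCross_symm hc⟩
    · refine Or.inl ⟨(i, j), ?_, rfl⟩
      simp only [hP, Finset.mem_filter, Finset.mem_product, Finset.mem_range]
      exact ⟨⟨hil, hjl⟩, h, hc⟩
  calc s.card ≤ (P.image Prod.fst ∪ P.image Prod.snd).card := Finset.card_le_card hsub
    _ ≤ (P.image Prod.fst).card + (P.image Prod.snd).card := Finset.card_union_le _ _
    _ ≤ 2 * P.card := by
      have h1 := Finset.card_image_le (s := P) (f := Prod.fst)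
      have h2 := Finset.card_image_le (s := P) (f := Prod.snd)
      omega

lemma cycleEdges_getD {m : ℕ} (hm : 0 < m) (l : List Pt) (hl : l.length = m) (j : Fin m)
    (d : Pt × Pt) :
    (cycleEdges l).getD j d =
      (l[j.val]'(hl ▸ j.isLt), l[(cycSucc hm j).val]'(hl ▸ (cycSucc hm j).isLt)) := by
  subst hl
  have hlen : j.val < (cycleEdges l).length := by
    simp [cycleEdges]
  rw [List.getD_eq_getElem _ _ hlen]
  simp [cycleEdges, List.getElem_rotate, cycSucc]

/-- The number of bichromatic pairs of consecutive points is at most twice the number of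
red runs. -/
lemma card_bridges_le {m : ℕ} (hm : 0 < m) {R B : Finset Pt} (hdisj : Disjoint R B)
    {pt : Fin m → Pt} (hmem : ∀ i, pt i ∈ R ∨ pt i ∈ B) (hB : ∃ i, pt i ∉ R) :
    (Finset.univ.filter fun i => Bichromatic R B (pt i, pt (cycSucc hm i))).card
      ≤ 2 * runCount hm R B pt := by
  have hnot : ¬ ∀ i : Fin m, pt i ∈ R := by simpa using hB
  have hx : ∀ i, pt i ∈ B ↔ pt i ∉ R := fun i =>
    ⟨fun h h' => Finset.disjoint_left.1 hdisj h' h, fun h => (hmem i).resolve_left h⟩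
  rw [runCount, if_neg hnot]
  set RB := Finset.univ.filter fun i : Fin m => pt i ∈ R ∧ pt (cycSucc hm i) ∉ R with hRB
  set BR := Finset.univ.filter fun i : Fin m => pt i ∉ R ∧ pt (cycSucc hm i) ∈ R with hBR
  have hrun : (Finset.univ.filter fun i : Fin m => pt i ∈ R ∧ pt (cycPred hm i) ∈ B).card
      = BR.card := by
    symm
    refine Finset.card_bij (fun i _ => cycSucc hm i) ?_ ?_ ?_
    · intro i hi
      simp only [hBR, Finset.mem_filter, Finset.mem_univ, true_and] at hi
      simp only [Finset.mem_filter, Finset.mem_univ, true_and, cycPred_cycSucc, hx]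
      exact ⟨hi.2, hi.1⟩
    · intro i _ j _ h
      exact cycSucc_injective hm h
    · intro i hi
      obtain ⟨k, rfl⟩ := (cycSucc_bijective hm).2 i
      simp only [Finset.mem_filter, Finset.mem_univ, true_and, cycPred_cycSucc, hx] at hi
      exact ⟨k, by simpa [hBR] using ⟨hi.2, hi.1⟩, rfl⟩
  have hbal : RB.card = BR.card := by
    set RR := Finset.univ.filter fun i : Fin m => pt i ∈ R ∧ pt (cycSucc hm i) ∈ R with hRR
    have e1 : (Finset.univ.filter fun i : Fin m => pt i ∈ R).card = RR.card + RB.card := by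
      rw [← Finset.card_filter_add_card_filter_not (s := Finset.univ.filter fun i => pt i ∈ R)
        (fun i => pt (cycSucc hm i) ∈ R), Finset.filter_filter, Finset.filter_filter]
    have e2 : (Finset.univ.filter fun i : Fin m => pt (cycSucc hm i) ∈ R).card
        = RR.card + BR.card := by
      rw [← Finset.card_filter_add_card_filter_not
        (s := Finset.univ.filter fun i => pt (cycSucc hm i) ∈ R)
        (fun i => pt i ∈ R), Finset.filter_filter, Finset.filter_filter]
      simp only [hRR, hBR, and_comm]
    have e3 : (Finset.univ.filter fun i : Fin m => pt (cycSucc hm i) ∈ R).card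
        = (Finset.univ.filter fun i : Fin m => pt i ∈ R).card :=
      Finset.card_bijective _ (cycSucc_bijective hm) (by simp)
    omega
  have hsub : (Finset.univ.filter fun i => Bichromatic R B (pt i, pt (cycSucc hm i)))
      ⊆ RB ∪ BR := by
    intro i hi
    simp only [Finset.mem_filter, Finset.mem_univ, true_and, Bichromatic, hx] at hi
    simpa [hRB, hBR] using hi
  have h1 := (Finset.card_le_card hsub).trans (Finset.card_union_le _ _)
  rw [hrun]
  omega

/-- On points in convex position, a Hamiltonian polygon with `c` crossings contains at least
`m - 2 c` edges of the convex hull. -/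
lemma le_card_hull_edges_add {m : ℕ} (hm : 0 < m) (hm3 : 3 ≤ m) {pt : Fin m → Pt}
    (hcw : CWList pt) (l : List Pt) (hl : l.length = m) (hnd : l.Nodup)
    (hmem : ∀ x, x ∈ l ↔ ∃ i, pt i = x) :
    m ≤ (Finset.univ.filter fun i =>
        IsEdgeOf (cycleEdges l) (pt i) (pt (cycSucc hm i))).card
      + 2 * crossNum (cycleEdges l) := by
  have hlt : ∀ j : Fin m, j.val < l.length := fun j => hl ▸ j.isLt
  choose σ₀ hσ₀ using fun j : Fin m => (hmem (l[j.val]'(hlt j))).1 (List.getElem_mem _)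
  have hinj : Function.Injective σ₀ := by
    intro i j h
    have h' : l[i.val]'(hlt i) = l[j.val]'(hlt j) := by rw [← hσ₀, ← hσ₀, h]
    exact Fin.ext ((hnd.getElem_inj_iff).1 h')
  let σ : Equiv.Perm (Fin m) := Equiv.ofBijective σ₀ (Finite.injective_iff_bijective.1 hinj)
  have hσ : ∀ j, pt (σ j) = l[j.val]'(hlt j) := hσ₀
  have hget : ∀ (j : Fin m) (d : Pt × Pt),
      (cycleEdges l).getD j d = (pt (σ j), pt (σ (cycSucc hm j))) := by
    intro j d
    rw [cycleEdges_getD hm l hl, hσ, hσ]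
  have hlen : (cycleEdges l).length = m := by simp [cycleEdges, hl]
  have hedge : ∀ j, (pt (σ j), pt (σ (cycSucc hm j))) ∈ cycleEdges l := by
    intro j
    have hj : j.val < (cycleEdges l).length := hlen ▸ j.isLt
    rw [← hget j ((0, 0), (0, 0)), List.getD_eq_getElem _ _ hj]
    exact List.getElem_mem _
  let hull : Fin m → Prop := fun j =>
    σ (cycSucc hm j) = cycSucc hm (σ j) ∨ σ j = cycSucc hm (σ (cycSucc hm j))
  have hcross : (Finset.univ.filter fun j => ¬ hull j).card ≤ 2 * crossNum (cycleEdges l) := by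
    rw [← Finset.card_image_of_injective _ Fin.val_injective]
    apply card_le_two_mul_crossNum
    intro i hi
    simp only [Finset.mem_image, Finset.mem_filter, Finset.mem_univ, true_and] at hi
    obtain ⟨j, hj, rfl⟩ := hi
    rw [not_or] at hj
    obtain ⟨k, hk, hc⟩ := exists_segCross hm hcw σ j hj.1 hj.2
      (cycSucc_ne_self hm (by omega) j)
    refine ⟨hlen ▸ j.isLt, k, hlen ▸ k.isLt, fun h => hk (Fin.ext h), ?_⟩
    rw [hget, hget]
    exact hc
  have hhull : (Finset.univ.filter fun j => hull j).card ≤ (Finset.univ.filter fun i =>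
        IsEdgeOf (cycleEdges l) (pt i) (pt (cycSucc hm i))).card := by
    refine Finset.card_le_card_of_injOn
      (fun j => if σ (cycSucc hm j) = cycSucc hm (σ j) then σ j else σ (cycSucc hm j)) ?_ ?_
    · intro j hj
      simp only [Finset.coe_filter, Finset.mem_univ, true_and, Set.mem_ofPred_eq] at hj ⊢
      split_ifs with h
      · rw [← h]
        exact Or.inl (hedge j)
      · rw [← hj.resolve_left h]
        exact Or.inr (hedge j)
    · intro i hi j hj hij
      simp only [Finset.coe_filter, Finset.mem_univ, true_and, Set.mem_ofPred_eq] at hi hj hij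
      have h3 := cycSucc_cycSucc_ne_self hm hm3
      split_ifs at hij with h h' h'
      · exact σ.injective hij
      · have hj' := hj.resolve_left h'
        have e1 := σ.injective hij
        have e2 : cycSucc hm i = j := σ.injective (by rw [h, hij, ← hj'])
        exact absurd (by rw [e2, ← e1]) (h3 i)
      · have hi' := hi.resolve_left h
        have e1 := σ.injective hij
        have e2 : cycSucc hm j = i := σ.injective (by rw [h', ← hij, ← hi'])
        exact absurd (by rw [e2, e1]) (h3 j)
      · exact cycSucc_injective hm (σ.injective hij)
  have htot : (Finset.univ.filter fun j => hull j).card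
      + (Finset.univ.filter fun j => ¬ hull j).card = m := by
    rw [Finset.card_filter_add_card_filter_not, Finset.card_univ, Fintype.card_fin]
  omega

/-- Theorem 3.1(iii): for `S = R ∪ B` in convex position (listed clockwise by `pt`) with
`|R| = |B| = n ≥ 2`, every bridge of `S` (an edge joining two consecutive points of
different colors in the circular order) is an edge of any Hamiltonian alternating cycle
on `S` having exactly `n − r(S)` crossings. -/
theorem stmt8 (n : ℕ) (hn : 2 ≤ n) (R B : Finset Pt)
    (hdisj : Disjoint R B)
    (hR : R.card = n) (hB : B.card = n)
    (m : ℕ) (hm : 0 < m) (pt : Fin m → Pt)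
    (hcw : CWList pt) (hcover : Finset.univ.image pt = R ∪ B) :
    ∀ C : HamAltCycle R B,
      crossNum (cycleEdges C.verts) = n - runCount hm R B pt →
      ∀ i : Fin m, Bichromatic R B (pt i, pt (cycSucc hm i)) →
        IsEdgeOf (cycleEdges C.verts) (pt i) (pt (cycSucc hm i)) := by
  intro C hC i hi
  have hcard : (R ∪ B).card = m := by
    rw [← hcover, Finset.card_image_of_injective _ hcw.1, Finset.card_univ, Fintype.card_fin]
  have hm2 : m = 2 * n := by
    rw [← hcard, Finset.card_union_of_disjoint hdisj]
    omega
  have hl : C.verts.length = m := by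
    rw [← hcard, ← C.cover, List.toFinset_card_of_nodup C.nodup]
  have hmem : ∀ x, x ∈ C.verts ↔ ∃ i, pt i = x := by
    intro x
    rw [← List.mem_toFinset, C.cover, ← hcover]
    simp
  have hpt : ∀ i, pt i ∈ R ∨ pt i ∈ B := by
    intro i
    rw [← Finset.mem_union, ← hcover]
    exact Finset.mem_image_of_mem _ (Finset.mem_univ i)
  have hblue : ∃ i, pt i ∉ R := by
    obtain ⟨x, hx⟩ : B.Nonempty := Finset.card_pos.1 (by omega)
    have hx' : x ∈ Finset.univ.image pt := hcover ▸ Finset.mem_union_right R hx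
    obtain ⟨i, -, rfl⟩ := Finset.mem_image.1 hx'
    exact ⟨i, fun h => Finset.disjoint_left.1 hdisj h hx⟩
  have hlow := le_card_hull_edges_add hm (by omega) hcw C.verts hl C.nodup hmem
  have hup := card_bridges_le hm hdisj hpt hblue
  have hup' := Finset.card_le_univ
    (Finset.univ.filter fun i => Bichromatic R B (pt i, pt (cycSucc hm i)))
  rw [Fintype.card_fin] at hup'
  have hsub : (Finset.univ.filter fun i =>
      IsEdgeOf (cycleEdges C.verts) (pt i) (pt (cycSucc hm i)))
      ⊆ Finset.univ.filter fun i => Bichromatic R B (pt i, pt (cycSucc hm i)) := by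
    intro k hk
    simp only [Finset.mem_filter, Finset.mem_univ, true_and] at hk ⊢
    rcases hk with hk | hk
    · exact C.alt _ hk
    · exact (C.alt _ hk).symm.imp And.symm And.symm
  have heq := Finset.eq_of_subset_of_card_le hsub (by omega)
  have hi' : i ∈ Finset.univ.filter fun i => Bichromatic R B (pt i, pt (cycSucc hm i)) := by
    simpa using hi
  rw [← heq] at hi'
  simpa using hi'
end
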